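/- For t > 0, any 0 < α < 1 (representing sin²(nπ/q)), the two expressions for the elliptic term agree: (1/(2 sin θ)) ∫_{−∞}^∞ e^{−tr²} e^{−2θ' r}/(1+e^{−2πr}) dr = (1/√(16πt)) ∫₀^∞ e^{−u²/(4t)} cosh(u/2)/(sinh²(u/2) + sin²θ) du, where θ = nπ/q ∈ (0,π) and θ' = πn/q (i.e. the exponent is −2πnr/q). -/

import Mathlib

open Real MeasureTheory

lemma ell_pointwise (s : ℂ) (y : ℝ) :
    |sigmoid y * (1 - sigmoid y)| •
      (((sigmoid y : ℝ) : ℂ) ^ ((1 - s) - 1) * (1 - ((sigmoid y : ℝ) : ℂ)) ^ (s - 1))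
    = Complex.exp (-s * y) / (1 + Complex.exp (-y)) := by
  have hp : (0:ℝ) < 1 + rexp (-y) := by positivity
  set L := Real.log (1 + rexp (-y)) with hL
  have hLe : rexp L = 1 + rexp (-y) := Real.exp_log hp
  have h1 : sigmoid y = rexp (-L) := by
    rw [sigmoid_def, Real.exp_neg L, hLe]
  have h2 : 1 - sigmoid y = rexp (-y - L) := by
    rw [← sigmoid_neg, ← sigmoid_mul_rexp_neg, h1, ← Real.exp_add]; congr 1; ring
  have h3 : (1 - ((sigmoid y : ℝ) : ℂ)) = ((rexp (-y - L) : ℝ) : ℂ) := by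
    rw [← h2]; push_cast; rfl
  have h4 : (1 + Complex.exp (-y)) = Complex.exp L := by
    have := congrArg (fun x : ℝ => (x : ℂ)) hLe
    push_cast at this
    exact this.symm
  have key (a : ℝ) (w : ℂ) : ((rexp a : ℝ) : ℂ) ^ w = Complex.exp (a * w) := by
    rw [Complex.cpow_def_of_ne_zero (by exact_mod_cast (Real.exp_pos a).ne'),
      ← Complex.ofReal_log (Real.exp_pos a).le, Real.log_exp]
  rw [h3, h2, h1, key, key, h4, abs_of_pos (by positivity), ← Real.exp_add, Complex.real_smul,
    Complex.ofReal_exp, ← Complex.exp_add, ← Complex.exp_add, ← Complex.exp_sub]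
  congr 1
  push_cast
  ring

lemma ell_beta (s : ℂ) (h0 : 0 < s.re) (h1 : s.re < 1) :
    Integrable (fun y : ℝ => Complex.exp (-s * y) / (1 + Complex.exp (-y))) ∧
    ∫ y : ℝ, Complex.exp (-s * y) / (1 + Complex.exp (-y)) = π / Complex.sin (π * s) := by
  have hs' : 0 < (1 - s).re := by simpa using h1
  have hd : ∀ x ∈ (Set.univ : Set ℝ), HasDerivWithinAt sigmoid (sigmoid x * (1 - sigmoid x)) Set.univ x :=
    fun x _ => (hasDerivAt_sigmoid x).hasDerivWithinAt
  have him : sigmoid '' Set.univ = Set.Ioo 0 1 := by rw [Set.image_univ, range_sigmoid]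
  have hc := Complex.betaIntegral_convergent hs' h0
  rw [intervalIntegrable_iff_integrableOn_Ioo_of_le zero_le_one, ← him,
    integrableOn_image_iff_integrableOn_abs_deriv_smul MeasurableSet.univ hd
      sigmoid_injective.injOn] at hc
  simp_rw [ell_pointwise] at hc
  refine ⟨by simpa using hc, ?_⟩
  have hG := Complex.Gamma_mul_Gamma_eq_betaIntegral hs' h0
  rw [mul_comm, Complex.Gamma_mul_Gamma_one_sub, sub_add_cancel, Complex.Gamma_one, one_mul,
    Complex.betaIntegral, intervalIntegral.integral_of_le zero_le_one,
    integral_Ioc_eq_integral_Ioo, ← him,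
    integral_image_eq_integral_abs_deriv_smul MeasurableSet.univ hd sigmoid_injective.injOn] at hG
  simp_rw [ell_pointwise] at hG
  rw [hG]; simp

lemma ell_g (θ : ℝ) (h0 : 0 < θ) (h1 : θ < π) (u : ℝ) :
    Integrable (fun r : ℝ => Complex.exp (Complex.I * r * u) *
      (Complex.exp (-2 * θ * r) / (1 + Complex.exp (-2 * π * r)))) ∧
    ∫ r : ℝ, Complex.exp (Complex.I * r * u) *
      (Complex.exp (-2 * θ * r) / (1 + Complex.exp (-2 * π * r)))
      = 1 / (2 * Complex.sin (θ - Complex.I * u / 2)) := by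
  have hpi : (π : ℂ) ≠ 0 := by exact_mod_cast pi_ne_zero
  obtain ⟨s, hs⟩ : ∃ s : ℂ, s = ((θ / π : ℝ) : ℂ) - Complex.I * ((u / (2 * π) : ℝ) : ℂ) := ⟨_, rfl⟩
  have hre : s.re = θ / π := by rw [hs]; simp [-Complex.ofReal_div]
  obtain ⟨hi, hv⟩ := ell_beta s (by rw [hre]; positivity)
    (by rw [hre, div_lt_one pi_pos]; exact h1)
  have heq : (fun r : ℝ => Complex.exp (Complex.I * r * u) *
      (Complex.exp (-2 * θ * r) / (1 + Complex.exp (-2 * π * r))))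
      = fun r : ℝ => (fun y : ℝ => Complex.exp (-s * y) / (1 + Complex.exp (-y))) ((2 * π) * r) := by
    funext r
    simp only
    rw [← mul_div_assoc, ← Complex.exp_add]
    congr 2
    · rw [hs]; push_cast; field_simp; ring
    · congr 1; push_cast; ring
  rw [heq]
  refine ⟨hi.comp_mul_left' (by positivity), ?_⟩
  rw [Measure.integral_comp_mul_left (fun y : ℝ => Complex.exp (-s * y) / (1 + Complex.exp (-y))), hv,
    abs_of_pos (by positivity), Complex.real_smul]
  have : (π : ℂ) * s = θ - Complex.I * u / 2 := by
    rw [hs]; push_cast; field_simp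
  rw [this]; push_cast
  rw [mul_inv, one_div, mul_inv]; field_simp

lemma ell_sin (θ u : ℝ) (h : 0 < Real.sin θ) :
    (1 / (2 * Complex.sin (θ - Complex.I * u / 2))).re
      = Real.sin θ * Real.cosh (u / 2) / (2 * (Real.sinh (u / 2) ^ 2 + Real.sin θ ^ 2)) := by
  have e : Complex.sin (θ - Complex.I * u / 2)
      = ((Real.sin θ * Real.cosh (u / 2) : ℝ) : ℂ)
        + ((-(Real.cos θ * Real.sinh (u / 2)) : ℝ) : ℂ) * Complex.I := by
    have : (θ - Complex.I * u / 2 : ℂ) = θ - ((u / 2 : ℝ) : ℂ) * Complex.I := by push_cast; ring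
    rw [this, Complex.sin_sub, Complex.cos_mul_I, Complex.sin_mul_I]
    push_cast; ring
  rw [e, one_div, Complex.inv_re]
  have hn : Complex.normSq (2 * (((Real.sin θ * Real.cosh (u / 2) : ℝ) : ℂ)
        + ((-(Real.cos θ * Real.sinh (u / 2)) : ℝ) : ℂ) * Complex.I))
      = 4 * (Real.sinh (u / 2) ^ 2 + Real.sin θ ^ 2) := by
    rw [Complex.normSq_mul, Complex.normSq_add_mul_I]
    norm_num
    rw [mul_pow, mul_pow, Real.cosh_sq, Real.cos_sq']; ring
  rw [hn]
  have hp : 0 < Real.sinh (u / 2) ^ 2 + Real.sin θ ^ 2 := by positivity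
  simp [-Complex.ofReal_mul, -Complex.ofReal_neg]
  field_simp
  try ring

lemma ell_main (t : ℝ) (ht : 0 < t) (θ : ℝ) (h0 : 0 < θ) (h1 : θ < π) :
    Real.sqrt (4 * π * t) * ∫ r : ℝ, Real.exp (-t * r ^ 2) *
          (Real.exp (-2 * θ * r) / (1 + Real.exp (-2 * π * r)))
      = Real.sin θ * ∫ u in Set.Ioi (0:ℝ),
            Real.exp (-u ^ 2 / (4 * t)) * Real.cosh (u / 2) /
              (Real.sinh (u / 2) ^ 2 + Real.sin θ ^ 2) := by
  have hsin := Real.sin_pos_of_pos_of_lt_pi h0 h1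
  have htc : (t : ℂ) ≠ 0 := by exact_mod_cast ht.ne'
  obtain ⟨g, hg⟩ : ∃ g : ℝ → ℂ, g = fun r : ℝ =>
    Complex.exp (-2 * θ * r) / (1 + Complex.exp (-2 * π * r)) := ⟨_, rfl⟩
  obtain ⟨G, hG⟩ : ∃ G : ℝ → ℂ, G = fun u : ℝ => Complex.exp (-(1 / (4 * t) : ℝ) * u ^ 2) :=
    ⟨_, rfl⟩
  have hb : 0 < (((1 / (4 * t) : ℝ)) : ℂ).re := by rw [Complex.ofReal_re]; positivity
  have hgi : Integrable g := by
    have := (ell_g θ h0 h1 0).1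
    simpa [hg] using this
  have hGi : Integrable G := by
    have := integrable_cexp_quadratic hb 0 0
    simpa [hG] using this
  have hF : Integrable (Function.uncurry fun r u : ℝ =>
      Complex.exp (Complex.I * r * u) * (g r * G u)) (volume.prod volume) := by
    refine (hgi.mul_prod hGi).bdd_mul (c := 1)
      (f := fun z : ℝ × ℝ => Complex.exp (Complex.I * z.1 * z.2)) ?_ ?_
    · exact (by fun_prop : Continuous _).aestronglyMeasurable
    · filter_upwards with z
      rw [Complex.norm_exp]; simp
  have hswap := integral_integral_swap hF
  have hint := hF.integral_prod_right
  have hL (r : ℝ) : ∫ u : ℝ, Complex.exp (Complex.I * r * u) * (g r * G u)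
      = ((Real.sqrt (4 * π * t) * (Real.exp (-t * r ^ 2) *
          (Real.exp (-2 * θ * r) / (1 + Real.exp (-2 * π * r)))) : ℝ) : ℂ) := by
    have h := fourierIntegral_gaussian hb r
    have : ∀ u : ℝ, Complex.exp (Complex.I * r * u) * (g r * G u)
      = g r * (Complex.exp (Complex.I * r * u) * Complex.exp (-(1 / (4 * t) : ℝ) * u ^ 2)) := by
      intro u; rw [hG]; ring
    simp_rw [this]
    rw [integral_const_mul, h]
    have hs : ((π : ℂ) / ((1 / (4 * t) : ℝ) : ℂ)) ^ (1 / 2 : ℂ) = ((Real.sqrt (4 * π * t) : ℝ) : ℂ) := by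
      rw [Real.sqrt_eq_rpow, Complex.ofReal_cpow (by positivity)]
      congr 1
      · push_cast; field_simp
      · push_cast; rfl
    rw [hs, hg]
    have he : -(r : ℂ) ^ 2 / (4 * ((1 / (4 * t) : ℝ) : ℂ)) = -t * r ^ 2 := by
      push_cast; field_simp
    rw [he]
    push_cast; ring
  have hR (u : ℝ) : ∫ r : ℝ, Complex.exp (Complex.I * r * u) * (g r * G u)
      = G u * (1 / (2 * Complex.sin (θ - Complex.I * u / 2))) := by
    rw [← (ell_g θ h0 h1 u).2, ← integral_const_mul]
    congr 1; funext r; rw [hg]; ring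
  have hre (u : ℝ) : (G u * (1 / (2 * Complex.sin (θ - Complex.I * u / 2)))).re
      = (fun u => Real.sin θ / 2 * (Real.exp (-u ^ 2 / (4 * t)) * Real.cosh (u / 2) /
              (Real.sinh (u / 2) ^ 2 + Real.sin θ ^ 2))) |u| := by
    have hGr : G u = ((Real.exp (-u ^ 2 / (4 * t)) : ℝ) : ℂ) := by
      rw [hG]; push_cast; congr 1; field_simp
    rw [hGr, Complex.re_ofReal_mul, ell_sin θ u hsin]
    have ha : |u| / 2 = |u / 2| := by rw [abs_div]; simp
    have hsh : Real.sinh |u / 2| ^ 2 = Real.sinh (u / 2) ^ 2 := by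
      rw [← Real.abs_sinh, sq_abs]
    simp only [ha, Real.cosh_abs, hsh, sq_abs]
    have hp : 0 < Real.sinh (u / 2) ^ 2 + Real.sin θ ^ 2 := by positivity
    field_simp
  simp only [Function.uncurry] at hint
  simp_rw [hR] at hint
  simp_rw [hL, hR] at hswap
  rw [integral_complex_ofReal] at hswap
  have h2 := congrArg Complex.re hswap
  have h3 := integral_re hint
  simp only [Complex.ofReal_re, RCLike.re_to_complex] at h2 h3
  rw [← h3] at h2
  rw [integral_congr_ae (Filter.Eventually.of_forall hre)] at h2
  have h4 := h2.trans (integral_comp_abs (f := fun u => Real.sin θ / 2 *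
    (Real.exp (-u ^ 2 / (4 * t)) * Real.cosh (u / 2) / (Real.sinh (u / 2) ^ 2 + Real.sin θ ^ 2))))
  rw [integral_const_mul, integral_const_mul] at h4
  rw [h4]; ring



/-- Parseval identity comparing the two expressions for the elliptic heat trace
term: for `t > 0` and `θ = nπ/q ∈ (0,π)` with `1 ≤ n ≤ q−1`,
`(1/(2 sin θ)) ∫_{−∞}^∞ e^{−tr²} e^{−2πnr/q}/(1+e^{−2πr}) dr
  = (1/√(16πt)) ∫₀^∞ e^{−u²/(4t)} cosh(u/2)/(sinh²(u/2)+sin²θ) du`. -/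
theorem elliptic_term_parseval (t : ℝ) (ht : 0 < t) (q n : ℕ) (hq : 0 < q)
    (hn1 : 1 ≤ n) (hn2 : n ≤ q - 1) :
    (1 / (2 * Real.sin (n * π / q))) *
        ∫ r : ℝ, Real.exp (-t * r ^ 2) *
          (Real.exp (-2 * (π * n / q) * r) / (1 + Real.exp (-2 * π * r)))
      = (1 / Real.sqrt (16 * π * t)) *
          ∫ u in Set.Ioi (0:ℝ),
            Real.exp (-u ^ 2 / (4 * t)) * Real.cosh (u / 2) /
              (Real.sinh (u / 2) ^ 2 + Real.sin (n * π / q) ^ 2) := by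
  have hq' : (0:ℝ) < q := by exact_mod_cast hq
  have hn' : (0:ℝ) < n := by exact_mod_cast hn1
  have hnq : (n:ℝ) < q := by
    have : n < q := by omega
    exact_mod_cast this
  have h0 : 0 < n * π / q := by positivity
  have h1 : n * π / q < π := by
    rw [div_lt_iff₀ hq', mul_comm]
    exact mul_lt_mul_of_pos_left hnq pi_pos
  have h := ell_main t ht (n * π / q) h0 h1
  have hsin := Real.sin_pos_of_pos_of_lt_pi h0 h1
  rw [mul_comm π (n : ℝ)]
  have hs : Real.sqrt (16 * π * t) = 2 * Real.sqrt (4 * π * t) := by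
    rw [show 16 * π * t = 2 ^ 2 * (4 * π * t) by ring, Real.sqrt_mul (by norm_num),
      Real.sqrt_sq (by norm_num)]
  have hsp : 0 < Real.sqrt (4 * π * t) := Real.sqrt_pos.2 (by positivity)
  rw [hs, div_mul_eq_mul_div, div_mul_eq_mul_div, div_eq_div_iff (by positivity) (by positivity)]
  linear_combination 2 * h
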